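/- Let K be a field, E a finite set, and W ⊆ K^E a configuration with dual configuration W^⊥ ⊆ K^E. Let ζ : K[x_e^{±1} : e ∈ E] → K[y_e^{±1} : e ∈ E] be the K-algebra isomorphism (Cremona isomorphism) determined by ζ(x_e) = y_e^{−1} for all e ∈ E. Then for suitable choices of bases, ζ maps the extensions of ⟨ψ_W⟩, J_W and M_W in K[x_e^{±1} : e ∈ E] onto the extensions of ⟨ψ_{W^⊥}⟩, J_{W^⊥} and M_{W^⊥} in K[y_e^{±1} : e ∈ E], respectively. In particular, ζ induces a bijection between the minimal primes over J_W (equivalently M_W) containing no coordinate x_e and the minimal primes over J_{W^⊥} (equivalently M_{W^⊥}) containing no coordinate y_e. -/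

import Mathlib

open scoped BigOperators

namespace Config

variable {K : Type} [Field K] {E : Type} [Fintype E] [DecidableEq E]

/-- `w` is a (linear) basis of the configuration `W ⊆ K^E`. -/
def IsBasisOf {r : ℕ} (w : Fin r → E → K) (W : Submodule K (E → K)) : Prop :=
  LinearIndependent K w ∧ Submodule.span K (Set.range w) = W

/-- The configuration (bilinear) form `Q_W` computed from the basis `w`: the symmetric
`r × r` matrix with entries `∑_{e ∈ E} x_e · w^i_e · w^j_e` over `K[x_e : e ∈ E]`. -/
noncomputable def Qform {r : ℕ} (w : Fin r → E → K) :
    Matrix (Fin r) (Fin r) (MvPolynomial E K) :=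
  Matrix.of fun i j => ∑ e : E, MvPolynomial.C (w i e * w j e) * MvPolynomial.X e

/-- The configuration polynomial `ψ_W = det Q_W` computed from the basis `w`. -/
noncomputable def psi {r : ℕ} (w : Fin r → E → K) : MvPolynomial E K :=
  (Qform w).det

/-- The ideal `M_W` generated by the submaximal, i.e. `(r−1) × (r−1)`, minors of the
configuration form `Q_W`. -/
noncomputable def minorIdeal {r : ℕ} (w : Fin r → E → K) : Ideal (MvPolynomial E K) :=
  Ideal.span {p | ∃ f g : Fin (r - 1) ↪ Fin r, p = Matrix.det ((Qform w).submatrix f g)}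

/-- The Jacobian ideal `J_W = ⟨ψ_W⟩ + ⟨∂ψ_W/∂x_e : e ∈ E⟩`. -/
noncomputable def jacIdeal {r : ℕ} (w : Fin r → E → K) : Ideal (MvPolynomial E K) :=
  Ideal.span ({psi w} ∪ Set.range fun e => MvPolynomial.pderiv e (psi w))

/-- The Laurent polynomial ring `K[x_e^{±1} : e ∈ E]`, realized as the localization of
the polynomial ring `K[x_e : e ∈ E]` away from the monomial `∏ₑ x_e`. -/
abbrev Laurent (K' : Type) [Field K'] (E' : Type) [Fintype E'] [DecidableEq E'] : Type :=
  Localization.Away (∏ e : E', (MvPolynomial.X e : MvPolynomial E' K'))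

open Matrix

/-- A pair of bases completed to mutually dual bases of the full space. -/
structure DualQuad {R m m' E : Type*} [CommRing R] [Fintype m] [Fintype m'] [Fintype E]
    [DecidableEq m] [DecidableEq m'] [DecidableEq E]
    (A B2 : Matrix m E R) (B A2 : Matrix m' E R) : Prop where
  h1 : A * Bᵀ = 0
  h2 : A2 * Bᵀ = 1
  h3 : A * B2ᵀ = 1
  h4 : A2 * B2ᵀ = 0
  h5 : B2ᵀ * A + Bᵀ * A2 = 1

section abstractPart

variable {R m m' F : Type*} [CommRing R] [Fintype m] [Fintype m'] [Fintype F]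
    [DecidableEq m] [DecidableEq m'] [DecidableEq F]
    {A B2 : Matrix m F R} {B A2 : Matrix m' F R}

lemma DualQuad.symm (h : DualQuad A B2 B A2) : DualQuad B A2 A B2 where
  h1 := by simpa using congrArg transpose h.h1
  h2 := by simpa using congrArg transpose h.h3
  h3 := by simpa using congrArg transpose h.h2
  h4 := by simpa using congrArg transpose h.h4
  h5 := by
    have := congrArg transpose h.h5
    rw [add_comm]
    simpa using this

lemma DualQuad.map {S : Type*} [CommRing S] (f : R →+* S) (h : DualQuad A B2 B A2) :
    DualQuad (A.map f) (B2.map f) (B.map f) (A2.map f) where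
  h1 := by rw [← transpose_map, ← Matrix.map_mul, h.h1]; simp
  h2 := by rw [← transpose_map, ← Matrix.map_mul, h.h2]; simp
  h3 := by rw [← transpose_map, ← Matrix.map_mul, h.h3]; simp
  h4 := by rw [← transpose_map, ← Matrix.map_mul, h.h4]; simp
  h5 := by
    rw [← transpose_map, ← transpose_map, ← Matrix.map_mul, ← Matrix.map_mul,
      ← Matrix.map_add _ (map_add f), h.h5]; simp

/-- the form `A diag(y) Aᵀ` -/
def gform (A : Matrix m F R) (y : F → R) : Matrix m m R := A * diagonal y * Aᵀ

lemma DualQuad.mulcore (h : DualQuad A B2 B A2) {x y : F → R} (hxy : ∀ e, x e * y e = 1) :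
    A * diagonal y * Aᵀ * (B2 * diagonal x) + A * diagonal y * A2ᵀ * (B * diagonal x) = A := by
  have h5 : Aᵀ * B2 + A2ᵀ * B = 1 := by simpa using congrArg transpose h.h5
  have hd : diagonal y * diagonal x = (1 : Matrix F F R) := by
    rw [diagonal_mul_diagonal, ← diagonal_one]; congr 1; ext e; rw [mul_comm, hxy]
  calc _ = A * diagonal y * (Aᵀ * B2 + A2ᵀ * B) * diagonal x := by
        simp only [Matrix.mul_add, Matrix.add_mul, Matrix.mul_assoc]
    _ = A * (diagonal y * diagonal x) := by rw [h5]; simp only [Matrix.mul_one, Matrix.mul_assoc]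
    _ = A := by rw [hd, Matrix.mul_one]

lemma DualQuad.mulcore2 (h : DualQuad A B2 B A2) {x y : F → R} (hxy : ∀ e, x e * y e = 1) :
    A2 * diagonal y * Aᵀ * (B2 * diagonal x) + A2 * diagonal y * A2ᵀ * (B * diagonal x) = A2 := by
  have h5 : Aᵀ * B2 + A2ᵀ * B = 1 := by simpa using congrArg transpose h.h5
  have hd : diagonal y * diagonal x = (1 : Matrix F F R) := by
    rw [diagonal_mul_diagonal, ← diagonal_one]; congr 1; ext e; rw [mul_comm, hxy]
  calc _ = A2 * diagonal y * (Aᵀ * B2 + A2ᵀ * B) * diagonal x := by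
        simp only [Matrix.mul_add, Matrix.add_mul, Matrix.mul_assoc]
    _ = A2 * (diagonal y * diagonal x) := by rw [h5]; simp only [Matrix.mul_one, Matrix.mul_assoc]
    _ = A2 := by rw [hd, Matrix.mul_one]

/-- The determinants of dual forms agree up to a unit, and the inverse-like formula holds. -/
lemma DualQuad.det_eq (h : DualQuad A B2 B A2) {x y : F → R} (hxy : ∀ e, x e * y e = 1) :
    ∃ u : R, IsUnit u ∧ (gform A y).det = u * (gform B x).det := by
  have k1 := h.mulcore hxy
  have k2 := h.mulcore2 hxy
  have e1 : A * diagonal y * Aᵀ * (B2 * diagonal x * Bᵀ) +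
      A * diagonal y * A2ᵀ * (B * diagonal x * Bᵀ) = 0 := by
    have := congrArg (· * Bᵀ) k1
    simpa only [Matrix.add_mul, Matrix.mul_assoc, h.h1] using this
  have e2 : A2 * diagonal y * Aᵀ * (B2 * diagonal x * Bᵀ) +
      A2 * diagonal y * A2ᵀ * (B * diagonal x * Bᵀ) = 1 := by
    have := congrArg (· * Bᵀ) k2
    simpa only [Matrix.add_mul, Matrix.mul_assoc, h.h2] using this
  have e3 : A * diagonal y * Aᵀ * (B2 * diagonal x * B2ᵀ) +
      A * diagonal y * A2ᵀ * (B * diagonal x * B2ᵀ) = 1 := by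
    have := congrArg (· * B2ᵀ) k1
    simpa only [Matrix.add_mul, Matrix.mul_assoc, h.h3] using this
  have e4 : A2 * diagonal y * Aᵀ * (B2 * diagonal x * B2ᵀ) +
      A2 * diagonal y * A2ᵀ * (B * diagonal x * B2ᵀ) = 0 := by
    have := congrArg (· * B2ᵀ) k2
    simpa only [Matrix.add_mul, Matrix.mul_assoc, h.h4] using this
  set N := fromBlocks (A * diagonal y * Aᵀ) (A * diagonal y * A2ᵀ)
    (A2 * diagonal y * Aᵀ) (A2 * diagonal y * A2ᵀ) with hN
  have hinv : N * fromBlocks (B2 * diagonal x * B2ᵀ) (B2 * diagonal x * Bᵀ)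
      (B * diagonal x * B2ᵀ) (B * diagonal x * Bᵀ) = 1 := by
    rw [hN, fromBlocks_multiply, e1, e2, e3, e4, fromBlocks_one]
  refine ⟨N.det, ?_, ?_⟩
  · have := congrArg det hinv
    rw [det_mul, det_one] at this
    exact IsUnit.of_mul_eq_one _ this
  · have hz : N * fromBlocks 1 (B2 * diagonal x * Bᵀ) 0 (B * diagonal x * Bᵀ) =
        fromBlocks (A * diagonal y * Aᵀ) 0 (A2 * diagonal y * Aᵀ) 1 := by
      rw [hN, fromBlocks_multiply, e1, e2]; simp
    have := congrArg det hz
    rw [det_mul, det_fromBlocks_zero₂₁, det_fromBlocks_zero₁₂, det_one, det_one, one_mul,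
      mul_one] at this
    rw [gform, gform, this]

lemma DualQuad.adj_eq [IsDomain R] (h : DualQuad A B2 B A2) {x y : F → R}
    (hxy : ∀ e, x e * y e = 1) (h0 : (gform A y).det ≠ 0) :
    ∃ u : R, IsUnit u ∧ (gform A y).det = u * (gform B x).det ∧
      (gform A y).adjugate = u • ((gform B x).det • (B2 * diagonal x * B2ᵀ) -
        (B2 * diagonal x * Bᵀ) * (gform B x).adjugate * (B * diagonal x * B2ᵀ)) := by
  obtain ⟨u, hu, hdet⟩ := h.det_eq hxy
  refine ⟨u, hu, hdet, ?_⟩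
  have k1 := h.mulcore hxy
  have e1 : gform A y * (B2 * diagonal x * Bᵀ) =
      - (A * diagonal y * A2ᵀ * gform B x) := by
    rw [eq_neg_iff_add_eq_zero]
    have := congrArg (· * Bᵀ) k1
    simpa only [gform, Matrix.add_mul, Matrix.mul_assoc, h.h1] using this
  have e3 : gform A y * (B2 * diagonal x * B2ᵀ) =
      1 - A * diagonal y * A2ᵀ * (B * diagonal x * B2ᵀ) := by
    rw [eq_sub_iff_add_eq]
    have := congrArg (· * B2ᵀ) k1
    simpa only [gform, Matrix.add_mul, Matrix.mul_assoc, h.h3] using this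
  set X := (gform B x).det • (B2 * diagonal x * B2ᵀ) -
        (B2 * diagonal x * Bᵀ) * (gform B x).adjugate * (B * diagonal x * B2ᵀ) with hX
  have hPX : gform A y * X = (gform B x).det • (1 : Matrix m m R) := by
    rw [hX, Matrix.mul_sub, Matrix.mul_smul, e3, ← Matrix.mul_assoc (gform A y),
      ← Matrix.mul_assoc (gform A y), e1,
      Matrix.neg_mul, Matrix.neg_mul, Matrix.mul_assoc _ (gform B x), mul_adjugate]
    simp [smul_sub]
  have h00 : (gform B x).det ≠ 0 := by
    intro hh; rw [hh, mul_zero] at hdet; exact h0 hdet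
  have := congrArg (fun Z => (gform A y).adjugate * Z) hPX
  simp only [← Matrix.mul_assoc, adjugate_mul, Matrix.smul_mul, Matrix.mul_smul, Matrix.one_mul,
    Matrix.mul_one] at this
  rw [hdet, mul_comm, mul_smul] at this
  exact (smul_right_injective _ h00 this).symm

/-- `det` and adjugate ideal -/
def mIdeal (P : Matrix m m R) : Ideal R :=
  Ideal.span ({P.det} ∪ Set.range fun ij : m × m => P.adjugate ij.1 ij.2)

/-- Jacobian-type ideal -/
def jIdeal (A : Matrix m F R) (P : Matrix m m R) : Ideal R :=
  Ideal.span ({P.det} ∪ Set.range fun e : F => (Aᵀ * P.adjugate * A) e e)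

lemma det_mem_mIdeal (P : Matrix m m R) : P.det ∈ mIdeal P :=
  Ideal.subset_span (Or.inl rfl)

lemma adj_mem_mIdeal (P : Matrix m m R) (i j : m) : P.adjugate i j ∈ mIdeal P :=
  Ideal.subset_span (Or.inr ⟨(i, j), rfl⟩)

lemma mul_mul_mem {l l' k k' : Type*} [Fintype k] [Fintype k'] (I : Ideal R) (M : Matrix l k R)
    (N : Matrix k k' R) (L : Matrix k' l' R) (hN : ∀ i j, N i j ∈ I) (i : l) (j : l') :
    (M * N * L) i j ∈ I := by
  simp only [Matrix.mul_apply, Finset.sum_mul]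
  refine I.sum_mem fun a _ => I.sum_mem fun b _ => ?_
  exact I.mul_mem_right _ (I.mul_mem_left _ (hN _ _))

lemma DualQuad.psi_le (h : DualQuad A B2 B A2) {x y : F → R}
    (hxy : ∀ e, x e * y e = 1) :
    Ideal.span {(gform A y).det} ≤ Ideal.span {(gform B x).det} := by
  obtain ⟨u, hu, hdet⟩ := h.det_eq hxy
  rw [Ideal.span_singleton_le_span_singleton, hdet]
  exact Dvd.intro_left u rfl

lemma DualQuad.m_le [IsDomain R] (h : DualQuad A B2 B A2) {x y : F → R}
    (hxy : ∀ e, x e * y e = 1) (h0 : (gform A y).det ≠ 0) :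
    mIdeal (gform A y) ≤ mIdeal (gform B x) := by
  obtain ⟨u, hu, hdet, hadj⟩ := h.adj_eq hxy h0
  refine Ideal.span_le.2 ?_
  rintro _ (rfl | ⟨⟨i, j⟩, rfl⟩)
  · rw [hdet]; exact Ideal.mul_mem_left _ _ (det_mem_mIdeal _)
  · simp only [hadj, Matrix.smul_apply, Matrix.sub_apply, smul_eq_mul]
    refine Ideal.mul_mem_left _ _ (Ideal.sub_mem _ ?_ ?_)
    · exact Ideal.mul_mem_right _ _ (det_mem_mIdeal _)
    · exact mul_mul_mem _ _ _ _ (adj_mem_mIdeal _) _ _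

lemma DualQuad.j_le [IsDomain R] (h : DualQuad A B2 B A2) {x y : F → R}
    (hxy : ∀ e, x e * y e = 1) (h0 : (gform A y).det ≠ 0) :
    jIdeal A (gform A y) ≤ jIdeal B (gform B x) := by
  obtain ⟨u, hu, hdet, hadj⟩ := h.adj_eq hxy h0
  have hd : (gform B x).det ∈ jIdeal B (gform B x) := Ideal.subset_span (Or.inl rfl)
  refine Ideal.span_le.2 ?_
  rintro _ (rfl | ⟨e, rfl⟩)
  · rw [hdet]; exact Ideal.mul_mem_left _ _ hd
  · have h5 : B2ᵀ * A = 1 - Bᵀ * A2 := eq_sub_of_add_eq h.h5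
    have h5' : Aᵀ * B2 = 1 - A2ᵀ * B := by
      simpa using congrArg transpose h5
    have hl : Aᵀ * (B2 * diagonal x * Bᵀ) = diagonal x * Bᵀ - A2ᵀ * gform B x := by
      rw [← Matrix.mul_assoc, ← Matrix.mul_assoc, h5', gform]
      simp only [Matrix.sub_mul, Matrix.one_mul, Matrix.mul_assoc]
    have hr : (B * diagonal x * B2ᵀ) * A = B * diagonal x - gform B x * A2 := by
      rw [Matrix.mul_assoc, h5, gform]
      simp only [Matrix.mul_sub, Matrix.mul_one, Matrix.mul_assoc]
    have key : Aᵀ * (gform A y).adjugate * A = u • ((gform B x).det •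
        (Aᵀ * (B2 * diagonal x * B2ᵀ) * A + A2ᵀ * (B * diagonal x) + diagonal x * Bᵀ * A2
          - A2ᵀ * gform B x * A2)
        - diagonal x * (Bᵀ * (gform B x).adjugate * B) * diagonal x) := by
      have e1 : Aᵀ * ((B2 * diagonal x * Bᵀ) * (gform B x).adjugate * (B * diagonal x * B2ᵀ)) * A
          = (diagonal x * Bᵀ - A2ᵀ * gform B x) * (gform B x).adjugate *
            (B * diagonal x - gform B x * A2) := by
        rw [← hl, ← hr]; simp only [Matrix.mul_assoc]
      have e2 : (diagonal x * Bᵀ - A2ᵀ * gform B x) * (gform B x).adjugate *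
            (B * diagonal x - gform B x * A2) =
          diagonal x * (Bᵀ * (gform B x).adjugate * B) * diagonal x
          - (gform B x).det • (A2ᵀ * (B * diagonal x)) - (gform B x).det • (diagonal x * Bᵀ * A2)
          + (gform B x).det • (A2ᵀ * gform B x * A2) := by
        have f1 : (diagonal x * Bᵀ - A2ᵀ * gform B x) * (gform B x).adjugate =
            diagonal x * Bᵀ * (gform B x).adjugate - (gform B x).det • A2ᵀ := by
          rw [Matrix.sub_mul, Matrix.mul_assoc A2ᵀ, mul_adjugate]; simp
        have f2 : diagonal x * Bᵀ * (gform B x).adjugate * (gform B x * A2) =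
            (gform B x).det • (diagonal x * Bᵀ * A2) := by
          rw [← Matrix.mul_assoc, Matrix.mul_assoc _ (adjugate _), adjugate_mul]; simp
        rw [f1, Matrix.sub_mul, Matrix.mul_sub, Matrix.mul_sub, f2]
        simp only [Matrix.mul_assoc, Matrix.smul_mul]
        abel
      rw [hadj, Matrix.mul_smul, Matrix.smul_mul, Matrix.mul_sub, Matrix.sub_mul, e1, e2,
        Matrix.mul_smul, Matrix.smul_mul]
      congr 1
      simp only [smul_sub, smul_add]
      abel
    simp only [key]
    simp only [Matrix.smul_apply, Matrix.sub_apply _ (diagonal x * _ * _), smul_eq_mul]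
    refine Ideal.mul_mem_left _ _ (Ideal.sub_mem _ ?_ ?_)
    · exact Ideal.mul_mem_right _ _ hd
    · rw [mul_diagonal, diagonal_mul]
      exact Ideal.mul_mem_right _ _ (Ideal.mul_mem_left _ _ (Ideal.subset_span (Or.inr ⟨e, rfl⟩)))

end abstractPart

section derivation

lemma derivation_prod {k S ι : Type*} [CommRing k] [CommRing S] [Algebra k S] [DecidableEq ι]
    (D : Derivation k S S) (s : Finset ι) (f : ι → S) :
    D (∏ i ∈ s, f i) = ∑ i ∈ s, D (f i) * ∏ j ∈ s.erase i, f j := by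
  induction s using Finset.induction_on with
  | empty => simp
  | insert a s ha ih =>
    rw [Finset.prod_insert ha, Derivation.leibniz, ih, Finset.sum_insert ha,
      Finset.erase_insert ha, smul_eq_mul, smul_eq_mul, Finset.mul_sum, add_comm, mul_comm]
    congr 1
    refine Finset.sum_congr rfl fun i hi => ?_
    have hai : a ≠ i := by rintro rfl; exact ha hi
    rw [Finset.erase_insert_of_ne hai, Finset.prod_insert (by simp [ha])]
    ring

lemma derivation_det {k S n : Type*} [CommRing k] [CommRing S] [Algebra k S] [DecidableEq n]
    [Fintype n] (D : Derivation k S S) (M : Matrix n n S) :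
    D M.det = ∑ i, ∑ j, M.adjugate i j * D (M j i) := by
  have h : D M.det = ∑ i, (M.updateCol i fun j => D (M j i)).det := by
    simp only [det_apply, map_sum]
    rw [Finset.sum_comm]
    refine Finset.sum_congr rfl fun σ _ => ?_
    rw [← Finset.smul_sum]
    have : D (Equiv.Perm.sign σ • ∏ i, M (σ i) i) = Equiv.Perm.sign σ • D (∏ i, M (σ i) i) := by
      rw [Units.smul_def, Units.smul_def, map_zsmul]
    rw [this, derivation_prod]
    congr 1
    refine Finset.sum_congr rfl fun i _ => ?_
    rw [← Finset.mul_prod_erase _ _ (Finset.mem_univ i), updateCol_self]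
    congr 1
    refine Finset.prod_congr rfl fun j hj => ?_
    rw [updateCol_ne (Finset.ne_of_mem_erase hj)]
  rw [h]
  refine Finset.sum_congr rfl fun i _ => ?_
  rw [← cramer_apply, cramer_eq_adjugate_mulVec]
  rfl

end derivation

section concrete

/-- coefficient matrix of a basis over the polynomial ring -/
noncomputable def cmat {r : ℕ} (w : Fin r → E → K) : Matrix (Fin r) E (MvPolynomial E K) :=
  (Matrix.of w).map MvPolynomial.C

lemma Qform_eq {r : ℕ} (w : Fin r → E → K) :
    Qform w = gform (cmat w) MvPolynomial.X := by
  ext1 i j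
  rw [gform, Matrix.mul_apply]
  simp only [Qform, cmat, Matrix.of_apply, mul_diagonal,
    Matrix.map_apply, transpose_apply, MvPolynomial.C_mul]
  exact Finset.sum_congr rfl fun e _ => by ring

lemma gform_map {R S m F : Type*} [CommRing R] [CommRing S] [Fintype F]
    [DecidableEq F] (g : R →+* S) (A : Matrix m F R) (y : F → R) :
    (gform A y).map g = gform (A.map g) (fun e => g (y e)) := by
  rw [gform, gform, Matrix.map_mul, Matrix.map_mul, transpose_map, diagonal_map (map_zero g)]

lemma adj_map {R S m : Type*} [CommRing R] [CommRing S] [Fintype m]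
    [DecidableEq m] (g : R →+* S) (P : Matrix m m R) :
    (P.map g).adjugate = P.adjugate.map g := (g.map_adjugate P).symm

lemma det_map' {R S m : Type*} [CommRing R] [CommRing S] [Fintype m]
    [DecidableEq m] (g : R →+* S) (P : Matrix m m R) :
    (P.map g).det = g P.det := (g.map_det P).symm

lemma mIdeal_map {R S m : Type*} [CommRing R] [CommRing S] [Fintype m]
    [DecidableEq m] (g : R →+* S) (P : Matrix m m R) :
    (mIdeal P).map g = mIdeal (P.map g) := by
  rw [mIdeal, mIdeal, Ideal.map_span, Set.image_union, Set.image_singleton, ← Set.range_comp,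
    det_map', adj_map]
  rfl

lemma jIdeal_map {R S m F : Type*} [CommRing R] [CommRing S] [Fintype m] [Fintype F]
    [DecidableEq m] (g : R →+* S) (A : Matrix m F R) (P : Matrix m m R) :
    (jIdeal A P).map g = jIdeal (A.map g) (P.map g) := by
  rw [jIdeal, jIdeal, Ideal.map_span, Set.image_union, Set.image_singleton, ← Set.range_comp,
    det_map', adj_map, ← transpose_map, ← Matrix.map_mul, ← Matrix.map_mul]
  rfl

lemma pderiv_psi {r : ℕ} (w : Fin r → E → K) (e : E) :
    MvPolynomial.pderiv e (psi w) = ((cmat w)ᵀ * (Qform w).adjugate * cmat w) e e := by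
  have hq : ∀ i j, MvPolynomial.pderiv e (Qform w j i) =
      MvPolynomial.C (w j e) * MvPolynomial.C (w i e) := by
    intro i j
    simp only [Qform, Matrix.of_apply, map_sum, MvPolynomial.pderiv_C_mul,
      MvPolynomial.pderiv_X]
    rw [Finset.sum_eq_single e]
    · simp
    · intro b _ hb
      simp [hb]
    · simp
  rw [psi, derivation_det]
  simp only [Matrix.mul_apply, cmat, Finset.sum_mul, transpose_apply, Matrix.map_apply,
    Matrix.of_apply, hq]
  rw [Finset.sum_comm]
  refine Finset.sum_congr rfl fun i _ => Finset.sum_congr rfl fun j _ => ?_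
  ring

lemma jacIdeal_eq {r : ℕ} (w : Fin r → E → K) : jacIdeal w = jIdeal (cmat w) (Qform w) := by
  rw [jacIdeal, jIdeal]
  simp only [pderiv_psi]
  rfl

lemma emb_eq {n : ℕ} (f : Fin n ↪ Fin (n + 1)) :
    ∃ (p : Fin (n + 1)) (σ : Equiv.Perm (Fin n)), ∀ i, f i = p.succAbove (σ i) := by
  have : ∃ p, ∀ i, f i ≠ p := by
    by_contra hcon
    push Not at hcon
    have hs : Function.Surjective f := hcon
    have := Fintype.card_le_of_surjective f hs
    simp at this
  obtain ⟨p, hp⟩ := this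
  have h1 : ∀ i, ∃ j, p.succAbove j = f i := fun i => Fin.exists_succAbove_eq (hp i)
  choose σ hσ using h1
  have hinj : Function.Injective σ := by
    intro a b hab
    apply f.injective
    rw [← hσ, ← hσ, hab]
  exact ⟨p, Equiv.ofBijective σ (Finite.injective_iff_bijective.1 hinj), fun i => (hσ i).symm⟩

lemma minor_eq {R : Type*} [CommRing R] : ∀ {r : ℕ} (P : Matrix (Fin r) (Fin r) R),
    Ideal.span {p | ∃ f g : Fin (r - 1) ↪ Fin r, p = Matrix.det (P.submatrix f g)} = mIdeal P
  | 0, P => by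
    have h1 : mIdeal P = ⊤ := by
      rw [Ideal.eq_top_iff_one]
      have := det_mem_mIdeal P
      rwa [det_isEmpty] at this
    rw [h1, Ideal.eq_top_iff_one]
    refine Ideal.subset_span ⟨Function.Embedding.refl _, Function.Embedding.refl _, ?_⟩
    exact (det_isEmpty (n := Fin 0)).symm
  | n + 1, P => by
    apply le_antisymm
    · refine Ideal.span_le.2 ?_
      rintro _ ⟨f, g, rfl⟩
      obtain ⟨p, σ, hp⟩ := emb_eq f
      obtain ⟨q, τ, hq⟩ := emb_eq g
      have hs : P.submatrix f g =
          ((P.submatrix p.succAbove q.succAbove).submatrix σ id).submatrix id τ := by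
        ext1 i j
        simp only [submatrix_apply, id]
        rw [← hp, ← hq]
      have ha := adjugate_fin_succ_eq_det_submatrix P q p
      have hm := adj_mem_mIdeal P q p
      have hd : (P.submatrix p.succAbove q.succAbove).det =
          (-1) ^ (p + q : ℕ) * P.adjugate q p := by
        rw [ha, ← mul_assoc, ← pow_add, ← two_mul, pow_mul]; simp
      change Matrix.det (P.submatrix f g) ∈ mIdeal P
      rw [hs]
      have := det_permute' τ ((P.submatrix p.succAbove q.succAbove).submatrix σ id)
      rw [this]
      have := det_permute σ (P.submatrix p.succAbove q.succAbove)
      rw [this, hd]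
      exact Ideal.mul_mem_left _ _ (Ideal.mul_mem_left _ _ (Ideal.mul_mem_left _ _ hm))
    · have hadj : ∀ i j, P.adjugate i j ∈ Ideal.span {p | ∃ f g : Fin (n + 1 - 1) ↪ Fin (n + 1),
          p = Matrix.det (P.submatrix f g)} := by
        intro i j
        rw [adjugate_fin_succ_eq_det_submatrix]
        refine Ideal.mul_mem_left _ _ (Ideal.subset_span ?_)
        exact ⟨j.succAboveEmb, i.succAboveEmb, rfl⟩
      refine Ideal.span_le.2 ?_
      rintro _ (rfl | ⟨⟨i, j⟩, rfl⟩)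
      · have h : (P * P.adjugate) 0 0 = P.det := by rw [mul_adjugate]; simp
        rw [← h, Matrix.mul_apply]
        exact Ideal.sum_mem _ fun k _ => Ideal.mul_mem_left _ _ (hadj _ _)
      · exact hadj i j

lemma minorIdeal_eq {r : ℕ} (w : Fin r → E → K) : minorIdeal w = mIdeal (Qform w) :=
  minor_eq _

lemma exists_right_inv {r : ℕ} (w : Fin r → E → K) (hw : LinearIndependent K w) :
    ∃ B2 : Matrix (Fin r) E K, Matrix.of w * B2ᵀ = 1 := by
  have hinj : Function.Injective (Matrix.of w).vecMul :=
    Matrix.vecMul_injective_iff.2 hw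
  obtain ⟨g, hg⟩ := LinearMap.exists_leftInverse_of_injective (Matrix.vecMulLinear (Matrix.of w))
    (LinearMap.ker_eq_bot.2 hinj)
  refine ⟨LinearMap.toMatrix' g, ?_⟩
  have h2 : LinearMap.toMatrix' g * (Matrix.of w)ᵀ = 1 := by
    have h3 : (Matrix.vecMulLinear (Matrix.of w)) = Matrix.toLin' (Matrix.of w)ᵀ := by
      ext1; ext; simp [Matrix.toLin'_apply]
    rw [h3] at hg
    have := congrArg LinearMap.toMatrix' hg
    rwa [LinearMap.toMatrix'_comp, LinearMap.toMatrix'_toLin', LinearMap.toMatrix'_id] at this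
  simpa using congrArg transpose h2

lemma exists_dualQuad (W Wperp : Submodule K (E → K))
    (hperp : ∀ v : E → K, v ∈ Wperp ↔ ∀ u ∈ W, ∑ e : E, u e * v e = 0)
    {r r' : ℕ} (w : Fin r → E → K) (w' : Fin r' → E → K)
    (hw : IsBasisOf w W) (hw' : IsBasisOf w' Wperp) :
    ∃ (B2 : Matrix (Fin r) E K) (A2 : Matrix (Fin r') E K),
      DualQuad (Matrix.of w) B2 (Matrix.of w') A2 := by
  obtain ⟨B2, hB2⟩ := exists_right_inv w hw.1
  have hperp' : ∀ v : E → K, (Matrix.of w) *ᵥ v = 0 → v ∈ Wperp := by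
    intro v hv
    rw [hperp]
    intro u hu
    rw [← hw.2] at hu
    induction hu using Submodule.span_induction with
    | mem x hx =>
      obtain ⟨i, rfl⟩ := hx
      exact congrFun hv i
    | zero => simp
    | add x y _ _ hx hy => simp [add_mul, Finset.sum_add_distrib, hx, hy]
    | smul c x _ hx => simp [mul_assoc, ← Finset.mul_sum, hx]
  have h1 : Matrix.of w * (Matrix.of w')ᵀ = 0 := by
    ext1 i j
    have hj : w' j ∈ Wperp := hw'.2 ▸ Submodule.subset_span ⟨j, rfl⟩
    have hi : w i ∈ W := hw.2 ▸ Submodule.subset_span ⟨i, rfl⟩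
    exact (hperp _).1 hj _ hi
  have hex : ∀ e : E, ∃ c : Fin r' → K, ∑ i, c i • w' i =
      fun e' => (1 - B2ᵀ * Matrix.of w : Matrix E E K) e' e := by
    intro e
    have hmem : (fun e' => (1 - B2ᵀ * Matrix.of w : Matrix E E K) e' e) ∈ Wperp := by
      apply hperp'
      have : Matrix.of w * (1 - B2ᵀ * Matrix.of w) = 0 := by
        rw [Matrix.mul_sub, ← Matrix.mul_assoc, hB2]; simp
      ext i
      exact congrFun (congrFun this i) e
    rw [← hw'.2] at hmem
    exact (Submodule.mem_span_range_iff_exists_fun K).1 hmem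
  choose c hc using hex
  have h5 : (Matrix.of w')ᵀ * Matrix.of (fun i e => c e i) = 1 - B2ᵀ * Matrix.of w := by
    ext e' e
    have := congrFun (hc e) e'
    rw [← this]
    simp [Matrix.mul_apply, mul_comm]
  obtain ⟨L, hL⟩ := exists_right_inv w' hw'.1
  have hL' : L * (Matrix.of w')ᵀ = 1 := by simpa using congrArg transpose hL
  set A2 := Matrix.of (fun i e => c e i) with hA2
  have hA : A2 = L * (1 - B2ᵀ * Matrix.of w) := by
    rw [← h5, ← Matrix.mul_assoc, hL', Matrix.one_mul]
  refine ⟨B2, A2, h1, ?_, hB2, ?_, ?_⟩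
  · rw [hA, Matrix.mul_assoc, Matrix.sub_mul, Matrix.mul_assoc, h1]; simp [hL']
  · rw [hA, Matrix.mul_assoc, Matrix.sub_mul, Matrix.mul_assoc, hB2]; simp
  · rw [h5]; abel

lemma psi_ne_zero {r : ℕ} (w : Fin r → E → K) (hw : LinearIndependent K w) : psi w ≠ 0 := by
  obtain ⟨B2, hB2⟩ := exists_right_inv w hw
  have hspan : Submodule.span K (Set.range (Matrix.of w)ᵀ) = ⊤ := by
    rw [eq_top_iff]
    intro v _
    have hv : (Matrix.of w) *ᵥ (B2ᵀ *ᵥ v) = v := by rw [mulVec_mulVec, hB2, one_mulVec]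
    rw [← hv]
    refine (Submodule.mem_span_range_iff_exists_fun K).2 ⟨B2ᵀ *ᵥ v, ?_⟩
    ext i
    simp [mulVec, dotProduct, mul_comm]
  obtain ⟨t, ht, hts, hli⟩ := exists_linearIndependent K (Set.range (Matrix.of w)ᵀ)
  rw [hspan] at hts
  let b := Module.Basis.mk hli (by rw [Subtype.range_coe, hts])
  have : Fintype t := FiniteDimensional.fintypeBasisIndex b
  have hcard : Fintype.card (Fin r) = Fintype.card t := by
    rw [← Module.finrank_eq_card_basis b]; simp
  let ε : Fin r ≃ t := Fintype.equivOfCardEq hcard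
  have hc : ∀ x : t, ∃ e : E, (Matrix.of w)ᵀ e = x := fun x => ht x.2
  choose c hc using hc
  have hinj : Function.Injective (c ∘ ε) := by
    intro a b' hab
    apply ε.injective
    apply Subtype.ext
    rw [← hc, ← hc]
    exact congrArg _ hab
  let M : Matrix (Fin r) (Fin r) K := (Matrix.of w).submatrix id (c ∘ ε)
  have hM : IsUnit M := by
    rw [← linearIndependent_cols_iff_isUnit]
    have h1 : M.col = (fun x : t => (x : Fin r → K)) ∘ ε := by
      funext k
      exact hc (ε k)
    rw [h1]
    exact hli.comp _ ε.injective
  classical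
  intro h0
  let x : E → K := fun e => if e ∈ Set.range (c ∘ ε) then 1 else 0
  have h1 : (Qform w).map (MvPolynomial.eval x) = M * Mᵀ := by
    ext1 i j
    simp only [Matrix.map_apply, Qform, Matrix.of_apply, map_sum, map_mul, MvPolynomial.eval_C,
      MvPolynomial.eval_X, Matrix.mul_apply, transpose_apply]
    rw [← Finset.sum_subset (Finset.subset_univ (Finset.univ.map ⟨c ∘ ε, hinj⟩)), Finset.sum_map]
    · refine Finset.sum_congr rfl fun k _ => ?_
      have hk : (c ∘ ε) k ∈ Set.range (c ∘ ε) := ⟨k, rfl⟩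
      have hxk : x ((c ∘ ε) k) = 1 := if_pos hk
      change w i ((c ∘ ε) k) * w j ((c ∘ ε) k) * x ((c ∘ ε) k) = _
      rw [hxk, mul_one]
      rfl
    · intro e _ he
      have : e ∉ Set.range (c ∘ ε) := by
        rintro ⟨k, rfl⟩
        exact he (by simp)
      simp only [x, if_neg this, mul_zero]
  have h2 := congrArg det h1
  rw [det_map'] at h2
  rw [psi] at h0
  rw [h0, map_zero, det_mul, det_transpose] at h2
  have := (isUnit_iff_isUnit_det M).1 hM
  exact (this.mul this).ne_zero h2.symm

end concrete

section primes

lemma bijOn_primes (I J : Ideal (MvPolynomial E K)) (ζ : Laurent K E ≃+* Laurent K E)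
    (h : Ideal.map ζ (Ideal.map (algebraMap (MvPolynomial E K) (Laurent K E)) I) =
      Ideal.map (algebraMap (MvPolynomial E K) (Laurent K E)) J) :
    Set.BijOn
        (fun p => Ideal.comap (algebraMap (MvPolynomial E K) (Laurent K E))
          (Ideal.map ζ (Ideal.map (algebraMap (MvPolynomial E K) (Laurent K E)) p)))
        {p : Ideal (MvPolynomial E K) |
          p ∈ I.minimalPrimes ∧ ∀ e : E, MvPolynomial.X e ∉ p}
        {p : Ideal (MvPolynomial E K) |
          p ∈ J.minimalPrimes ∧ ∀ e : E, MvPolynomial.X e ∉ p} := by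
  let S := Submonoid.powers (∏ e : E, (MvPolynomial.X e : MvPolynomial E K))
  have hdisj : ∀ p : Ideal (MvPolynomial E K), p.IsPrime → (∀ e : E, MvPolynomial.X e ∉ p) →
      Disjoint (S : Set (MvPolynomial E K)) p := by
    intro p hp hX
    rw [Set.disjoint_left]
    rintro _ ⟨n, rfl⟩ hmem
    have := hp.mem_of_pow_mem n hmem
    obtain ⟨e, _, he⟩ := (hp.prod_mem_iff).1 this
    exact hX e he
  have hround : ∀ p : Ideal (MvPolynomial E K), p.IsPrime → (∀ e : E, MvPolynomial.X e ∉ p) →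
      Ideal.comap (algebraMap (MvPolynomial E K) (Laurent K E))
        (Ideal.map (algebraMap (MvPolynomial E K) (Laurent K E)) p) = p := fun p hp hX =>
    IsLocalization.under_map_of_isPrime_disjoint S (Laurent K E) hp (hdisj p hp hX)
  have hround2 : ∀ q : Ideal (Laurent K E),
      Ideal.map (algebraMap (MvPolynomial E K) (Laurent K E))
        (Ideal.comap (algebraMap (MvPolynomial E K) (Laurent K E)) q) = q := fun q =>
    IsLocalization.map_under S (Laurent K E) q
  have hup : ∀ (L p : Ideal (MvPolynomial E K)),
      p ∈ L.minimalPrimes → (∀ e : E, MvPolynomial.X e ∉ p) →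
      Ideal.map (algebraMap (MvPolynomial E K) (Laurent K E)) p ∈
        (Ideal.map (algebraMap (MvPolynomial E K) (Laurent K E)) L).minimalPrimes := by
    intro L p hp hX
    rw [IsLocalization.minimalPrimes_map S (Laurent K E), Set.mem_preimage, Ideal.under_def,
      hround p hp.1.1 hX]
    exact hp
  have hdown : ∀ (L : Ideal (MvPolynomial E K)) (q : Ideal (Laurent K E)),
      q ∈ (Ideal.map (algebraMap (MvPolynomial E K) (Laurent K E)) L).minimalPrimes →
      Ideal.comap (algebraMap (MvPolynomial E K) (Laurent K E)) q ∈ L.minimalPrimes ∧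
      ∀ e : E, MvPolynomial.X e ∉
        Ideal.comap (algebraMap (MvPolynomial E K) (Laurent K E)) q := by
    intro L q hq
    refine ⟨?_, ?_⟩
    · rw [IsLocalization.minimalPrimes_map S (Laurent K E)] at hq
      exact hq
    · intro e he
      have hu : IsUnit (algebraMap (MvPolynomial E K) (Laurent K E) (MvPolynomial.X e)) := by
        have := IsLocalization.Away.algebraMap_isUnit (S := Laurent K E)
          (∏ e : E, (MvPolynomial.X e : MvPolynomial E K))
        exact isUnit_of_dvd_unit (map_dvd _ (Finset.dvd_prod_of_mem _ (Finset.mem_univ e))) this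
      exact hq.1.1.ne_top (Ideal.eq_top_of_isUnit_mem _ he hu)
  have hz : ∀ (η : Laurent K E ≃+* Laurent K E) (L q : Ideal (Laurent K E)),
      q ∈ L.minimalPrimes → Ideal.map η q ∈ (Ideal.map η L).minimalPrimes := by
    intro η L q hq
    have h1 : ∀ T : Ideal (Laurent K E), Ideal.map η T = Ideal.comap (η.symm : _ →+* _) T :=
      fun T => (Ideal.comap_symm η).symm
    rw [h1, h1]
    exact Ideal.minimalPrimes_comap_of_surjective η.symm.surjective hq
  have hzz : ∀ q : Ideal (Laurent K E), Ideal.map ζ (Ideal.map ζ.symm q) = q := by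
    intro q
    rw [Ideal.map_symm]
    exact Ideal.map_comap_of_surjective _ ζ.surjective q
  have hzz' : ∀ q : Ideal (Laurent K E), Ideal.map ζ.symm (Ideal.map ζ q) = q := by
    intro q
    rw [Ideal.map_symm]
    exact Ideal.comap_map_of_bijective _ ζ.bijective
  refine ⟨?_, ?_, ?_⟩
  · rintro p ⟨hp, hX⟩
    apply hdown
    rw [← h]
    exact hz _ _ _ (hup _ _ hp hX)
  · rintro p ⟨hp, hX⟩ p' ⟨hp', hX'⟩ heq
    have := congrArg (fun T => Ideal.comap (algebraMap (MvPolynomial E K) (Laurent K E))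
      (Ideal.map ζ.symm (Ideal.map (algebraMap (MvPolynomial E K) (Laurent K E)) T))) heq
    simp only [hround2, hzz'] at this
    rwa [hround p hp.1.1 hX, hround p' hp'.1.1 hX'] at this
  · rintro p ⟨hp, hX⟩
    refine ⟨Ideal.comap (algebraMap (MvPolynomial E K) (Laurent K E))
      (Ideal.map ζ.symm (Ideal.map (algebraMap (MvPolynomial E K) (Laurent K E)) p)), ?_, ?_⟩
    · apply hdown
      have := hz ζ.symm _ _ (hup _ _ hp hX)
      rwa [← h, hzz'] at this
    · simp only [hround2, hzz]
      exact hround p hp.1.1 hX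

end primes

/-- **Theorem (Cremona isomorphism).**
Let `W ⊆ K^E` be a configuration with dual configuration `W^⊥`, and let `ζ` be the
`K`-algebra automorphism of the Laurent polynomial ring with `ζ(x_e) = x_e⁻¹`.  Then
`ζ` maps the extensions of `⟨ψ_W⟩`, `J_W` and `M_W` onto the extensions of
`⟨ψ_{W^⊥}⟩`, `J_{W^⊥}` and `M_{W^⊥}`; in particular it induces a bijection between
the minimal primes over `J_W` containing no coordinate and the minimal primes over
`J_{W^⊥}` containing no coordinate. -/
theorem cremona_isomorphism_maps_ideals
    (W Wperp : Submodule K (E → K))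
    (hperp : ∀ v : E → K, v ∈ Wperp ↔ ∀ u ∈ W, ∑ e : E, u e * v e = 0)
    {r r' : ℕ} (w : Fin r → E → K) (w' : Fin r' → E → K)
    (hw : IsBasisOf w W) (hw' : IsBasisOf w' Wperp) :
    ∀ ζ : Laurent K E ≃+* Laurent K E,
      (∀ k : K, ζ (algebraMap (MvPolynomial E K) (Laurent K E) (MvPolynomial.C k)) =
          algebraMap (MvPolynomial E K) (Laurent K E) (MvPolynomial.C k)) →
      (∀ e : E, ζ (algebraMap (MvPolynomial E K) (Laurent K E) (MvPolynomial.X e)) *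
          algebraMap (MvPolynomial E K) (Laurent K E) (MvPolynomial.X e) = 1) →
      (Ideal.map ζ (Ideal.map (algebraMap (MvPolynomial E K) (Laurent K E))
          (Ideal.span {psi w})) =
        Ideal.map (algebraMap (MvPolynomial E K) (Laurent K E)) (Ideal.span {psi w'})) ∧
      (Ideal.map ζ (Ideal.map (algebraMap (MvPolynomial E K) (Laurent K E)) (jacIdeal w)) =
        Ideal.map (algebraMap (MvPolynomial E K) (Laurent K E)) (jacIdeal w')) ∧
      (Ideal.map ζ (Ideal.map (algebraMap (MvPolynomial E K) (Laurent K E)) (minorIdeal w)) =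
        Ideal.map (algebraMap (MvPolynomial E K) (Laurent K E)) (minorIdeal w')) ∧
      Set.BijOn
        (fun p => Ideal.comap (algebraMap (MvPolynomial E K) (Laurent K E))
          (Ideal.map ζ (Ideal.map (algebraMap (MvPolynomial E K) (Laurent K E)) p)))
        {p : Ideal (MvPolynomial E K) |
          p ∈ (jacIdeal w).minimalPrimes ∧ ∀ e : E, MvPolynomial.X e ∉ p}
        {p : Ideal (MvPolynomial E K) |
          p ∈ (jacIdeal w').minimalPrimes ∧ ∀ e : E, MvPolynomial.X e ∉ p} := by
  intro ζ hC hX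
  obtain ⟨B2, A2, hD⟩ := exists_dualQuad W Wperp hperp w w' hw hw'
  have hne : (∏ e : E, (MvPolynomial.X e : MvPolynomial E K)) ≠ 0 :=
    Finset.prod_ne_zero_iff.2 fun e _ => MvPolynomial.X_ne_zero e
  have hle : Submonoid.powers (∏ e : E, (MvPolynomial.X e : MvPolynomial E K)) ≤
      nonZeroDivisors _ := powers_le_nonZeroDivisors_of_noZeroDivisors hne
  have hdom : IsDomain (Laurent K E) := IsLocalization.isDomain_localization hle
  set φ := algebraMap (MvPolynomial E K) (Laurent K E) with hφ
  have hφinj : Function.Injective φ := IsLocalization.injective _ hle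
  let η : MvPolynomial E K →+* Laurent K E := (ζ : Laurent K E →+* Laurent K E).comp φ
  have hmap : ∀ I : Ideal (MvPolynomial E K), Ideal.map ζ (Ideal.map φ I) = Ideal.map η I :=
    fun I => Ideal.map_map φ (ζ : Laurent K E →+* Laurent K E)
  let x : E → Laurent K E := fun e => φ (MvPolynomial.X e)
  let y : E → Laurent K E := fun e => ζ (φ (MvPolynomial.X e))
  have hyx : ∀ e, y e * x e = 1 := hX
  have hxy : ∀ e, x e * y e = 1 := fun e => by rw [mul_comm]; exact hyx e
  have hQ := hD.map (φ.comp MvPolynomial.C)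
  set A := (Matrix.of w).map (φ.comp MvPolynomial.C) with hA
  set B := (Matrix.of w').map (φ.comp MvPolynomial.C) with hB
  have hcw : (cmat w).map η = A := by
    ext1 i j
    exact hC (w i j)
  have hcw' : (cmat w').map φ = B := rfl
  have hP : (Qform w).map η = gform A y := by
    rw [Qform_eq, gform_map, hcw]; rfl
  have hq : (Qform w').map φ = gform B x := by
    rw [Qform_eq, gform_map, hcw']
  have h0 : (gform A y).det ≠ 0 := by
    rw [← hP, det_map']
    intro hh
    refine psi_ne_zero w hw.1 (hφinj (ζ.injective ?_))
    rw [map_zero, map_zero]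
    exact hh
  have h0' : (gform B x).det ≠ 0 := by
    rw [← hq, det_map']
    intro hh
    refine psi_ne_zero w' hw'.1 (hφinj ?_)
    rw [map_zero]
    exact hh
  have hj : Ideal.map ζ (Ideal.map φ (jacIdeal w)) = Ideal.map φ (jacIdeal w') := by
    rw [hmap, jacIdeal_eq, jacIdeal_eq, jIdeal_map, jIdeal_map, hP, hq, hcw, hcw']
    exact le_antisymm (hQ.j_le hxy h0) (hQ.symm.j_le hyx h0')
  refine ⟨?_, hj, ?_, bijOn_primes _ _ ζ hj⟩
  · rw [hmap, Ideal.map_span, Ideal.map_span, Set.image_singleton, Set.image_singleton, psi, psi,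
      ← det_map', ← det_map', hP, hq]
    exact le_antisymm (hQ.psi_le hxy) (hQ.symm.psi_le hyx)
  · rw [hmap, minorIdeal_eq, minorIdeal_eq, mIdeal_map, mIdeal_map, hP, hq]
    exact le_antisymm (hQ.m_le hxy h0) (hQ.symm.m_le hyx h0')

end Config
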